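/- arXiv:1106.1395 — 9 statements merged into one kernel-verified Lean document; each statement's English description precedes it below -/
import Mathlib

section
/- Let σ > 0, λ > 0, μ ∈ ℝ, and let J̃ be a real number with J̃ > −1 and J̃ ≠ 0. Define π̃* = −(1/(2·J̃))·( 1 − (μ/σ²)·J̃ − √( (1 − (μ/σ²)·J̃)² + 4·((μ + λ·J̃)/σ²)·J̃ ) ). Then 1 + π̃*·J̃ > 0 and π̃* satisfies the log-utility first-order condition: μ − σ²·π̃* + λ·J̃·(1 + π̃*·J̃)^{−1} = 0. -/
/-- The explicit log-utility optimal investment fraction satisfies the positivity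
constraint and the first-order condition. -/
theorem log_utility_explicit_solution (σ lam μ Jt : ℝ) (hσ : 0 < σ) (hlam : 0 < lam)
    (hJ1 : -1 < Jt) (hJ : Jt ≠ 0) :
    1 + (-(1 / (2 * Jt)) * (1 - (μ / σ ^ 2) * Jt -
        Real.sqrt ((1 - (μ / σ ^ 2) * Jt) ^ 2 + 4 * ((μ + lam * Jt) / σ ^ 2) * Jt))) * Jt > 0 ∧
    μ - σ ^ 2 * (-(1 / (2 * Jt)) * (1 - (μ / σ ^ 2) * Jt -
        Real.sqrt ((1 - (μ / σ ^ 2) * Jt) ^ 2 + 4 * ((μ + lam * Jt) / σ ^ 2) * Jt))) +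
      lam * Jt * (1 + (-(1 / (2 * Jt)) * (1 - (μ / σ ^ 2) * Jt -
        Real.sqrt ((1 - (μ / σ ^ 2) * Jt) ^ 2 + 4 * ((μ + lam * Jt) / σ ^ 2) * Jt))) * Jt)⁻¹ = 0 := by
  set a := μ / σ ^ 2 * Jt with ha
  set s := Real.sqrt ((1 - a) ^ 2 + 4 * ((μ + lam * Jt) / σ ^ 2) * Jt) with hs
  have hdisc : (1 - a) ^ 2 + 4 * ((μ + lam * Jt) / σ ^ 2) * Jt =
      (1 + a) ^ 2 + 4 * (lam * Jt ^ 2 / σ ^ 2) := by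
    rw [ha]; ring
  have hc : 0 < lam * Jt ^ 2 / σ ^ 2 := by positivity
  have hsq : s ^ 2 = (1 + a) ^ 2 + 4 * (lam * Jt ^ 2 / σ ^ 2) := by
    rw [hs, hdisc, Real.sq_sqrt (by positivity)]
  have hw : 1 + (-(1 / (2 * Jt)) * (1 - a - s)) * Jt = (1 + a + s) / 2 := by
    field_simp
    ring
  have hpos : 0 < 1 + a + s := by
    have h : |1 + a| < s := abs_lt_of_sq_lt_sq (by linarith) (Real.sqrt_nonneg _)
    linarith [(abs_lt.mp h).1]
  rw [hw]
  refine ⟨by linarith, ?_⟩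
  have hμ : μ = a * σ ^ 2 / Jt := by rw [ha]; field_simp
  have hlam_eq : lam * Jt = σ ^ 2 / Jt * ((1 + a + s) * (s - (1 + a)) / 4) := by
    have h : (1 + a + s) * (s - (1 + a)) / 4 = lam * Jt ^ 2 / σ ^ 2 := by
      linear_combination hsq / 4
    rw [h]; field_simp
  rw [hlam_eq]
  clear_value s a
  rw [hμ]
  field_simp
  ring
end

section
/- Let σ > 0, λ > 0, μ ∈ ℝ, and let J̃ be a real number with J̃ > −1 and J̃ ≠ 0. Then there is exactly one real number π̃ with 1 + π̃·J̃ > 0 satisfying μ − σ²·π̃ + λ·J̃·(1 + π̃·J̃)^{−1} = 0, namely π̃* = −(1/(2·J̃))·( 1 − (μ/σ²)·J̃ − √( (1 − (μ/σ²)·J̃)² + 4·((μ + λ·J̃)/σ²)·J̃ ) ). -/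
/-- A monic quadratic with negative constant term has exactly one positive root. -/
theorem pos_and_quadratic_eq_zero_iff {b k : ℝ} (hk : 0 < k) (y : ℝ) :
    (0 < y ∧ y ^ 2 - b * y - k = 0) ↔ y = (b + √(b ^ 2 + 4 * k)) / 2 := by
  have hr := Real.sq_sqrt (show 0 ≤ b ^ 2 + 4 * k by positivity)
  have hb : |b| < √(b ^ 2 + 4 * k) := by
    rw [← Real.sqrt_sq_eq_abs]
    exact Real.sqrt_lt_sqrt (sq_nonneg b) (by linarith)
  obtain ⟨hb₁, hb₂⟩ := abs_lt.mp hb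
  generalize √(b ^ 2 + 4 * k) = r at *
  constructor
  · rintro ⟨hy, h⟩
    have hprod : (2 * y - b - r) * (2 * y - b + r) = 0 := by linear_combination 4 * h - hr
    rcases mul_eq_zero.mp hprod with h' | h' <;> linarith
  · rintro rfl
    exact ⟨by linarith, by linear_combination hr / 4⟩


/-- There is exactly one real number π̃ with 1 + π̃·J̃ > 0 satisfying the log-utility
first-order condition, namely the explicit formula. -/
theorem log_utility_unique_solution (σ lam μ Jt : ℝ) (hσ : 0 < σ) (hlam : 0 < lam)
    (hJ1 : -1 < Jt) (hJ : Jt ≠ 0) :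
    ∀ π : ℝ, (1 + π * Jt > 0 ∧ μ - σ ^ 2 * π + lam * Jt * (1 + π * Jt)⁻¹ = 0) ↔
      π = -(1 / (2 * Jt)) * (1 - (μ / σ ^ 2) * Jt -
        Real.sqrt ((1 - (μ / σ ^ 2) * Jt) ^ 2 + 4 * ((μ + lam * Jt) / σ ^ 2) * Jt)) := by
  intro π
  have hdisc : (1 - (μ / σ ^ 2) * Jt) ^ 2 + 4 * ((μ + lam * Jt) / σ ^ 2) * Jt =
      (1 + μ / σ ^ 2 * Jt) ^ 2 + 4 * (lam / σ ^ 2 * Jt ^ 2) := by ring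
  have hquad (hy : 1 + π * Jt > 0) : μ - σ ^ 2 * π + lam * Jt * (1 + π * Jt)⁻¹ = 0 ↔
      (1 + π * Jt) ^ 2 - (1 + μ / σ ^ 2 * Jt) * (1 + π * Jt) - lam / σ ^ 2 * Jt ^ 2 = 0 := by
    have hfactor : (1 + π * Jt) ^ 2 - (1 + μ / σ ^ 2 * Jt) * (1 + π * Jt) -
        lam / σ ^ 2 * Jt ^ 2 = -(Jt * (1 + π * Jt) / σ ^ 2) *
          (μ - σ ^ 2 * π + lam * Jt * (1 + π * Jt)⁻¹) := by
      have := hy.ne'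
      field_simp
      ring
    have hne : -(Jt * (1 + π * Jt) / σ ^ 2) ≠ 0 :=
      neg_ne_zero.mpr (div_ne_zero (mul_ne_zero hJ hy.ne') (by positivity))
    rw [hfactor, mul_eq_zero, or_iff_right hne]
  rw [and_congr_right hquad, gt_iff_lt, pos_and_quadratic_eq_zero_iff (by positivity), hdisc]
  constructor <;> intro h
  · field_simp at h ⊢
    linear_combination h
  · rw [h]
    field_simp
    ring
end

section
/- Let σ > 0, λ > 0, μ ∈ ℝ, and let J̃ be a real number with J̃ > −1 and J̃ ≠ 0. Let π̃* be the unique real number with 1 + π̃*·J̃ > 0 satisfying μ − σ²·π̃* + λ·J̃·(1 + π̃*·J̃)^{−1} = 0. Then π̃* has the same sign as the average drift μ + λ·J̃: π̃* > 0 if and only if μ + λ·J̃ > 0, π̃* = 0 if and only if μ + λ·J̃ = 0, and π̃* < 0 if and only if μ + λ·J̃ < 0. -/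
/-- The log-utility optimal investment fraction has the same sign as the average
drift μ + λ·J̃. -/
theorem log_utility_sign (σ lam μ Jt π : ℝ) (hσ : 0 < σ) (hlam : 0 < lam)
    (hJ1 : -1 < Jt) (hJ : Jt ≠ 0)
    (hpos : 1 + π * Jt > 0)
    (hfoc : μ - σ ^ 2 * π + lam * Jt * (1 + π * Jt)⁻¹ = 0) :
    (π > 0 ↔ μ + lam * Jt > 0) ∧ (π = 0 ↔ μ + lam * Jt = 0) ∧ (π < 0 ↔ μ + lam * Jt < 0) := by
  have hfactor : 0 < σ ^ 2 + lam * Jt ^ 2 * (1 + π * Jt)⁻¹ := by positivity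
  have hdrift : μ + lam * Jt = π * (σ ^ 2 + lam * Jt ^ 2 * (1 + π * Jt)⁻¹) := by
    have hinv : (1 + π * Jt) * (1 + π * Jt)⁻¹ = 1 := mul_inv_cancel₀ hpos.ne'
    linear_combination hfoc - lam * Jt * hinv
  rw [hdrift]
  exact ⟨(mul_pos_iff_of_pos_right hfactor).symm, by simp [hfactor.ne'],
    by simp [mul_neg_iff, hfactor, hfactor.not_gt]⟩
end

section
/- Let σ > 0, λ > 0, μ ∈ ℝ, β ≥ 1, and let J̃ be a real number with J̃ > −1 and J̃ ≠ 0. Then there exists a unique real number π̃ with 1 + π̃·J̃ > 0 satisfying μ − β·σ²·π̃ + λ·J̃·(1 + π̃·J̃)^{−β} = 0. In other words, an optimal investment fraction always exists and is unique for a fixed jump size. -/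
theorem strictAntiOn_sub_mul_add_mul_rpow_neg {a c d β : ℝ} (hc : 0 < c) (hd : 0 < d)
    (hβ : 0 < β) :
    StrictAntiOn (fun y : ℝ => a - c * y + d * y ^ (-β)) (Set.Ioi 0) := by
  intro x hx y _ hxy
  have hpow : y ^ (-β) < x ^ (-β) := Real.rpow_lt_rpow_of_neg hx hxy (neg_neg_of_pos hβ)
  have hlin := mul_lt_mul_of_pos_left hxy hc
  have hpow' := mul_lt_mul_of_pos_left hpow hd
  dsimp only
  linarith

theorem exists_pos_sub_mul_add_mul_rpow_neg_eq_zero {a c d β : ℝ} (hc : 0 < c) (hd : 0 < d)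
    (hβ : 0 < β) : ∃ y : ℝ, 0 < y ∧ a - c * y + d * y ^ (-β) = 0 := by
  have hs : 0 < |a| + c + d := by positivity
  set m : ℝ := ((|a| + c + d) / d) ^ (-β⁻¹) with hm
  set M : ℝ := (|a| + c + d) / c with hM
  have hm0 : 0 < m := by positivity
  have hm1 : m ≤ 1 := by
    refine Real.rpow_le_one_of_one_le_of_nonpos ?_ (by simpa using hβ.le)
    rw [one_le_div hd]
    linarith [abs_nonneg a]
  have hM1 : 1 ≤ M := by
    rw [hM, one_le_div hc]
    linarith [abs_nonneg a]
  have hmpow : d * m ^ (-β) = |a| + c + d := by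
    rw [hm, ← Real.rpow_mul (by positivity), neg_mul_neg, inv_mul_cancel₀ hβ.ne',
      Real.rpow_one]
    field_simp
  have hMpow : M ^ (-β) ≤ 1 :=
    Real.rpow_le_one_of_one_le_of_nonpos hM1 (neg_nonpos.2 hβ.le)
  have hMlin : c * M = |a| + c + d := by
    rw [hM]
    field_simp
  have hcont : ContinuousOn (fun y : ℝ => a - c * y + d * y ^ (-β)) (Set.Icc m M) := by
    refine ContinuousOn.add (by fun_prop) (continuousOn_const.mul ?_)
    exact continuousOn_id.rpow_const fun y hy => Or.inl (hm0.trans_le hy.1).ne'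
  obtain ⟨y, hy, hy0⟩ := intermediate_value_Icc' (hm1.trans hM1) hcont
    (show (0 : ℝ) ∈ Set.Icc _ _ by
      constructor
      · nlinarith [le_abs_self a]
      · nlinarith [neg_abs_le a])
  exact ⟨y, hm0.trans_le hy.1, hy0⟩

/-- For power utility with β ≥ 1, the optimal investment fraction exists and is
unique for a fixed jump size. -/
theorem power_utility_exists_unique (σ lam μ β Jt : ℝ) (hσ : 0 < σ) (hlam : 0 < lam)
    (hβ : 1 ≤ β) (hJ1 : -1 < Jt) (hJ : Jt ≠ 0) :
    ∃! π : ℝ, 1 + π * Jt > 0 ∧ μ - β * σ ^ 2 * π + lam * Jt * (1 + π * Jt) ^ (-β) = 0 := by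
  have hβ0 : 0 < β := one_pos.trans_le hβ
  have hc : 0 < β * σ ^ 2 := by positivity
  have hd : 0 < lam * Jt ^ 2 := by positivity
  have key : ∀ π : ℝ, μ - β * σ ^ 2 * π + lam * Jt * (1 + π * Jt) ^ (-β) = 0 ↔
      (μ * Jt + β * σ ^ 2) - β * σ ^ 2 * (1 + π * Jt)
        + lam * Jt ^ 2 * (1 + π * Jt) ^ (-β) = 0 := by
    intro π
    rw [← mul_eq_zero_iff_right hJ]
    ring_nf
  obtain ⟨y, hy, hy0⟩ := exists_pos_sub_mul_add_mul_rpow_neg_eq_zero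
    (a := μ * Jt + β * σ ^ 2) hc hd hβ0
  have hπ : 1 + (y - 1) / Jt * Jt = y := by
    rw [div_mul_cancel₀ _ hJ]
    ring
  refine ⟨(y - 1) / Jt, ⟨by rwa [hπ], by rwa [key, hπ]⟩, ?_⟩
  rintro π ⟨hpos, hzero⟩
  have heq : 1 + π * Jt = y :=
    (strictAntiOn_sub_mul_add_mul_rpow_neg hc hd hβ0).injOn hpos hy
      (((key π).1 hzero).trans hy0.symm)
  rw [eq_div_iff hJ]
  linarith
end

section
/- Let σ > 0, λ > 0, μ ∈ ℝ, β ≥ 1, and let J̃ be a real number with J̃ > −1 and J̃ ≠ 0. Let π̃*(β) be the unique real number with 1 + π̃*(β)·J̃ > 0 satisfying μ − β·σ²·π̃*(β) + λ·J̃·(1 + π̃*(β)·J̃)^{−β} = 0. Then π̃*(β) has the same sign as the average drift μ + λ·J̃: it is positive, zero, or negative exactly when μ + λ·J̃ is positive, zero, or negative, respectively. -/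
/-- For a positive fraction `p`, the gap between the jump's contribution to the average drift and
its marginal-utility-weighted value is positive. -/
theorem jump_mul_one_sub_rpow_pos {β J p : ℝ} (hβ : 0 < β) (hJ : J ≠ 0)
    (hx : 0 < 1 + p * J) (hp : 0 < p) : 0 < J * (1 - (1 + p * J) ^ (-β)) := by
  rcases hJ.lt_or_gt with h | h
  · have := Real.one_lt_rpow_of_pos_of_lt_one_of_neg hx
      (by linarith [mul_neg_of_pos_of_neg hp h]) (neg_lt_zero.mpr hβ)
    exact mul_pos_of_neg_of_neg h (by linarith)
  · have := Real.rpow_lt_one_of_one_lt_of_neg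
      (show 1 < 1 + p * J by linarith [mul_pos hp h]) (neg_lt_zero.mpr hβ)
    exact mul_pos h (by linarith)

/-- For a negative fraction `p`, that gap is negative. -/
theorem jump_mul_one_sub_rpow_neg {β J p : ℝ} (hβ : 0 < β) (hJ : J ≠ 0)
    (hx : 0 < 1 + p * J) (hp : p < 0) : J * (1 - (1 + p * J) ^ (-β)) < 0 := by
  have h := jump_mul_one_sub_rpow_pos (p := -p) (J := -J) hβ (neg_ne_zero.mpr hJ)
    (by simpa using hx) (neg_pos.mpr hp)
  rw [neg_mul_neg] at h
  linarith

/-- The power-utility optimal investment fraction has the same sign as the average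
drift μ + λ·J̃. -/
theorem power_utility_sign (σ lam μ β Jt π : ℝ) (hσ : 0 < σ) (hlam : 0 < lam)
    (hβ : 1 ≤ β) (hJ1 : -1 < Jt) (hJ : Jt ≠ 0)
    (hpos : 1 + π * Jt > 0)
    (hfoc : μ - β * σ ^ 2 * π + lam * Jt * (1 + π * Jt) ^ (-β) = 0) :
    (π > 0 ↔ μ + lam * Jt > 0) ∧ (π = 0 ↔ μ + lam * Jt = 0) ∧ (π < 0 ↔ μ + lam * Jt < 0) := by
  have hβ0 : 0 < β := by linarith
  have hc : 0 < β * σ ^ 2 := by positivity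
  have hdrift : μ + lam * Jt =
      β * σ ^ 2 * π + lam * (Jt * (1 - (1 + π * Jt) ^ (-β))) := by linarith
  rcases lt_trichotomy π 0 with h | h | h
  · have hD : μ + lam * Jt < 0 := by
      rw [hdrift]
      exact add_neg (mul_neg_of_pos_of_neg hc h)
        (mul_neg_of_pos_of_neg hlam (jump_mul_one_sub_rpow_neg hβ0 hJ hpos h))
    simp [h, hD, h.ne, hD.ne, h.not_gt, hD.not_gt]
  · have hD : μ + lam * Jt = 0 := by
      rw [hdrift, h]
      simp
    simp [h, hD]
  · have hD : 0 < μ + lam * Jt := by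
      rw [hdrift]
      exact add_pos (mul_pos hc h)
        (mul_pos hlam (jump_mul_one_sub_rpow_pos hβ0 hJ hpos h))
    simp [h, hD, h.ne', hD.ne', h.not_gt, hD.not_gt]
end

section
/- Let σ > 0, λ > 0, μ ∈ ℝ, and let J̃ be a real number with J̃ > −1 and J̃ ≠ 0. Let π̄* be the unique real number satisfying μ − σ²·π̄* + λ·J̃·exp(−π̄*·J̃) = 0. Then π̄* has the same sign as the average drift μ + λ·J̃: it is positive, zero, or negative exactly when μ + λ·J̃ is positive, zero, or negative, respectively. -/
theorem mul_one_sub_exp_neg_nonneg (x : ℝ) : 0 ≤ x * (1 - Real.exp (-x)) := by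
  rcases le_total 0 x with hx | hx
  · exact mul_nonneg hx (sub_nonneg.2 (Real.exp_le_one_iff.2 (neg_nonpos.2 hx)))
  · exact mul_nonneg_of_nonpos_of_nonpos hx
      (sub_nonpos.2 (Real.one_le_exp (neg_nonneg.2 hx)))

/-- The exponential-utility optimal (normalized) investment amount has the same
sign as the average drift μ + λ·J̃. -/
theorem exp_utility_sign (σ lam μ Jt π : ℝ) (hσ : 0 < σ) (hlam : 0 < lam)
    (hJ1 : -1 < Jt) (hJ : Jt ≠ 0)
    (hfoc : μ - σ ^ 2 * π + lam * Jt * Real.exp (-π * Jt) = 0) :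
    (π > 0 ↔ μ + lam * Jt > 0) ∧ (π = 0 ↔ μ + lam * Jt = 0) ∧ (π < 0 ↔ μ + lam * Jt < 0) := by
  have hprod : π * (μ + lam * Jt) =
      σ ^ 2 * π ^ 2 + lam * (π * Jt * (1 - Real.exp (-(π * Jt)))) := by
    rw [← neg_mul]
    linear_combination π * hfoc
  have hnonneg := mul_nonneg hlam.le (mul_one_sub_exp_neg_nonneg (π * Jt))
  have hzero : π = 0 → μ + lam * Jt = 0 := by
    rintro rfl
    simpa using hfoc
  have hsame : π ≠ 0 → 0 < π * (μ + lam * Jt) := fun hπ => by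
    have : 0 < σ ^ 2 * π ^ 2 := by positivity
    linarith
  rcases lt_trichotomy π 0 with hπ | hπ | hπ
  · have hm := neg_of_mul_pos_right (hsame hπ.ne) hπ.le
    simp [hπ, hm, hπ.ne, hm.ne, hπ.not_gt, hm.not_gt]
  · simp [hπ, hzero hπ]
  · have hm := pos_of_mul_pos_right (hsame hπ.ne') hπ.le
    simp [hπ, hm, hπ.ne', hm.ne', hπ.not_gt, hm.not_gt]
end

section
/- Let σ > 0, λ > 0, μ ∈ ℝ, and let J̃ be a real number with J̃ > −1 and J̃ ≠ 0. For each β ≥ 1 let π̃*(β) be the unique real number with 1 + π̃*(β)·J̃ > 0 satisfying μ − β·σ²·π̃*(β) + λ·J̃·(1 + π̃*(β)·J̃)^{−β} = 0. Then π̃*(β) tends to 0 as β → ∞. -/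
/-- A solution of the first-order condition satisfies a bound that is uniform in the
relative risk aversion. -/
theorem abs_mul_le_of_firstOrderCondition {σ lam μ Jt β p : ℝ} (hlam : 0 < lam) (hβ : 0 ≤ β)
    (hpos : 0 < 1 + p * Jt)
    (h : μ - β * σ ^ 2 * p + lam * Jt * (1 + p * Jt) ^ (-β) = 0) :
    |β * σ ^ 2 * (p * Jt)| ≤ |μ * Jt| + lam * Jt ^ 2 := by
  have hr : 0 < (1 + p * Jt) ^ (-β) := Real.rpow_pos_of_pos hpos _
  have hl : 0 ≤ lam * Jt ^ 2 := by positivity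
  have heq : β * σ ^ 2 * (p * Jt) = μ * Jt + lam * Jt ^ 2 * (1 + p * Jt) ^ (-β) := by
    linear_combination -Jt * h
  have hlr : 0 ≤ lam * Jt ^ 2 * (1 + p * Jt) ^ (-β) := by positivity
  have hm := neg_abs_le (μ * Jt)
  refine abs_le.2 ⟨by linarith, ?_⟩
  rcases le_total 0 (p * Jt) with hp | hp
  · have h1 : (1 + p * Jt) ^ (-β) ≤ 1 :=
      Real.rpow_le_one_of_one_le_of_nonpos (by linarith) (by linarith)
    have := mul_le_mul_of_nonneg_left h1 hl
    linarith [le_abs_self (μ * Jt)]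
  · have : β * σ ^ 2 * (p * Jt) ≤ 0 := mul_nonpos_of_nonneg_of_nonpos (by positivity) hp
    linarith [abs_nonneg (μ * Jt)]

/-- The power-utility optimal investment fraction tends to 0 in the limit of
infinite relative risk aversion. -/
theorem power_utility_fraction_tendsto_zero (σ lam μ Jt : ℝ) (hσ : 0 < σ) (hlam : 0 < lam)
    (hJ1 : -1 < Jt) (hJ : Jt ≠ 0) (πf : ℝ → ℝ)
    (hπf : ∀ β ≥ 1, 1 + πf β * Jt > 0 ∧
      μ - β * σ ^ 2 * πf β + lam * Jt * (1 + πf β * Jt) ^ (-β) = 0) :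
    Filter.Tendsto πf Filter.atTop (nhds 0) := by
  have hJ' : 0 < |Jt| := abs_pos.2 hJ
  refine squeeze_zero_norm' (a := fun β => (|μ * Jt| + lam * Jt ^ 2) / (σ ^ 2 * |Jt|) / β) ?_
    (Filter.tendsto_id.const_div_atTop _)
  filter_upwards [Filter.eventually_ge_atTop 1] with β hβ
  have hβ' : 0 < β := by linarith
  have h := abs_mul_le_of_firstOrderCondition hlam hβ'.le (hπf β hβ).1 (hπf β hβ).2
  rw [Real.norm_eq_abs, div_div, le_div_iff₀ (by positivity)]
  rw [abs_mul, abs_mul (πf β), abs_of_pos (by positivity : 0 < β * σ ^ 2)] at h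
  linarith
end

section
/- Let σ > 0, λ > 0, μ ∈ ℝ, and let J̃ be a real number with J̃ > −1 and J̃ ≠ 0. For each β ≥ 1 let π̃*(β) be the unique real number with 1 + π̃*(β)·J̃ > 0 satisfying μ − β·σ²·π̃*(β) + λ·J̃·(1 + π̃*(β)·J̃)^{−β} = 0, and let π̄* be the unique real number satisfying μ − σ²·π̄* + λ·J̃·exp(−π̄*·J̃) = 0. Then lim_{β → ∞} β·π̃*(β) = π̄*. -/
open Filter Topology in
/-- Version of `Real.tendsto_one_add_div_rpow_exp` with negated exponent. -/
theorem tendsto_one_add_div_rpow_neg_exp (y : ℝ) :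
    Tendsto (fun β : ℝ => (1 + y / β) ^ (-β)) atTop (𝓝 (Real.exp (-y))) := by
  rw [Real.exp_neg]
  refine ((Real.tendsto_one_add_div_rpow_exp y).inv₀ (Real.exp_pos y).ne').congr' ?_
  have h1 : Tendsto (fun β : ℝ => 1 + y / β) atTop (𝓝 (1 + 0)) :=
    tendsto_const_nhds.add (tendsto_const_nhds.div_atTop tendsto_id)
  filter_upwards [h1.eventually_const_lt (by norm_num : (0 : ℝ) < 1 + 0)] with β h
  exact (Real.rpow_neg h.le β).symm

theorem exp_neg_le_one_add_div_rpow_neg {y β : ℝ} (hβ : 0 < β) (h : 0 < 1 + y / β) :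
    Real.exp (-y) ≤ (1 + y / β) ^ (-β) := by
  rw [Real.exp_neg, Real.rpow_neg h.le]
  gcongr
  calc (1 + y / β) ^ β ≤ Real.exp (y / β) ^ β := by
        gcongr
        linarith [Real.add_one_le_exp (y / β)]
    _ = Real.exp y := by rw [← Real.exp_mul, div_mul_cancel₀ _ hβ.ne']

open Filter Topology in
/-- Solutions of `a - s * y + c * (1 + y / β) ^ (-β) = 0` converge to the solution of
`a - s * y + c * exp (-y) = 0` as `β → ∞`. -/
theorem tendsto_of_rpow_equation {a s c z : ℝ} (hs : 0 < s) (hc : 0 < c) (y : ℝ → ℝ)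
    (hy : ∀ᶠ β in atTop, 0 < 1 + y β / β ∧ a - s * y β + c * (1 + y β / β) ^ (-β) = 0)
    (hz : a - s * z + c * Real.exp (-z) = 0) :
    Tendsto y atTop (𝓝 z) := by
  have hlower : ∀ᶠ β in atTop, z ≤ y β := by
    filter_upwards [hy, eventually_gt_atTop 0] with β ⟨hpos, heq⟩ hβ
    by_contra! hlt
    have h1 := mul_le_mul_of_nonneg_left (exp_neg_le_one_add_div_rpow_neg hβ hpos) hc.le
    have h2 := mul_lt_mul_of_pos_left (Real.exp_lt_exp.2 (neg_lt_neg hlt)) hc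
    have h3 := mul_lt_mul_of_pos_left hlt hs
    linarith
  have hbound : Tendsto (fun β : ℝ => (a + c * (1 + z / β) ^ (-β)) / s) atTop (𝓝 z) := by
    have h := (((tendsto_one_add_div_rpow_neg_exp z).const_mul c).const_add a).div_const s
    rwa [show (a + c * Real.exp (-z)) / s = z by field_simp; linarith] at h
  have h1 : Tendsto (fun β : ℝ => 1 + z / β) atTop (𝓝 (1 + 0)) :=
    tendsto_const_nhds.add (tendsto_const_nhds.div_atTop tendsto_id)
  refine tendsto_of_tendsto_of_tendsto_of_le_of_le' tendsto_const_nhds hbound hlower ?_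
  filter_upwards [hy, hlower, eventually_gt_atTop 0,
    h1.eventually_const_lt (by norm_num : (0 : ℝ) < 1 + 0)] with β ⟨_, heq⟩ hle hβ hzpos
  have hmono : (1 + y β / β) ^ (-β) ≤ (1 + z / β) ^ (-β) :=
    Real.rpow_le_rpow_of_nonpos hzpos (by gcongr) (by linarith)
  rw [le_div_iff₀ hs]
  linarith [mul_le_mul_of_nonneg_left hmono hc.le]

/-- In the high risk aversion limit, the power-utility optimal fraction scaled by β
converges to the exponential-utility constant π̄*. -/
theorem power_utility_limit_exp_utility (σ lam μ Jt : ℝ) (hσ : 0 < σ) (hlam : 0 < lam)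
    (hJ1 : -1 < Jt) (hJ : Jt ≠ 0) (πf : ℝ → ℝ) (πbar : ℝ)
    (hπf : ∀ β ≥ 1, 1 + πf β * Jt > 0 ∧
      μ - β * σ ^ 2 * πf β + lam * Jt * (1 + πf β * Jt) ^ (-β) = 0)
    (hπbar : μ - σ ^ 2 * πbar + lam * Jt * Real.exp (-πbar * Jt) = 0) :
    Filter.Tendsto (fun β => β * πf β) Filter.atTop (nhds πbar) := by
  have key : Filter.Tendsto (fun β => β * πf β * Jt) Filter.atTop (nhds (πbar * Jt)) := by
    refine tendsto_of_rpow_equation (a := μ * Jt) (s := σ ^ 2) (c := lam * Jt ^ 2)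
      (by positivity) (by positivity) _ ?_ ?_
    · filter_upwards [Filter.eventually_ge_atTop 1] with β hβ
      have hβ0 : β ≠ 0 := by positivity
      obtain ⟨hpos, heq⟩ := hπf β hβ
      rw [show β * πf β * Jt / β = πf β * Jt by field_simp]
      exact ⟨hpos, by linear_combination Jt * heq⟩
    · rw [← neg_mul]
      linear_combination Jt * hπbar
  simpa [hJ] using key.div_const Jt
end

section
/- Let σ > 0, β > 0, μ ∈ ℝ, and let ν be a finite nonzero Borel measure on ℝ such that the function z ↦ e^z is ν-integrable. Then the function F : [0,1) → ℝ defined by F(π) = μ − β·σ²·π + ∫ (e^z − 1)·(1 + π·(e^z − 1))^{−β} dν(z) is well defined (the integrand is ν-integrable for every π ∈ [0,1)) and strictly decreasing on [0,1). -/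
open MeasureTheory

lemma one_sub_le_one_add_mul {p x : ℝ} (hp : 0 ≤ p) (hx : -1 ≤ x) : 1 - p ≤ 1 + p * x := by
  nlinarith [mul_nonneg hp (neg_le_iff_add_nonneg.mp hx)]

lemma antitoneOn_mul_one_add_mul_rpow_neg {β x : ℝ} (hβ : 0 ≤ β) (hx : -1 ≤ x) :
    AntitoneOn (fun p : ℝ => x * (1 + p * x) ^ (-β)) (Set.Ico 0 1) := by
  intro p hp q hq hpq
  have hp_pos : 0 < 1 + p * x := by linarith [one_sub_le_one_add_mul hp.1 hx, hp.2]
  have hq_pos : 0 < 1 + q * x := by linarith [one_sub_le_one_add_mul hq.1 hx, hq.2]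
  rcases le_total 0 x with h | h
  · refine mul_le_mul_of_nonneg_left ?_ h
    exact Real.rpow_le_rpow_of_nonpos hp_pos
      (by linarith [mul_le_mul_of_nonneg_right hpq h]) (neg_nonpos.mpr hβ)
  · refine mul_le_mul_of_nonpos_left ?_ h
    exact Real.rpow_le_rpow_of_nonpos hq_pos
      (by linarith [mul_le_mul_of_nonpos_right hpq h]) (neg_nonpos.mpr hβ)

lemma integrable_mul_one_add_mul_rpow_neg {α : Type*} [MeasurableSpace α] {ν : Measure α}
    {f : α → ℝ} (hf : Integrable f ν) (hf_ge : ∀ z, -1 ≤ f z) {β p : ℝ} (hβ : 0 ≤ β)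
    (hp : p ∈ Set.Ico (0 : ℝ) 1) :
    Integrable (fun z => f z * (1 + p * f z) ^ (-β)) ν := by
  have hp1 : 0 < 1 - p := sub_pos.mpr hp.2
  refine hf.mul_bdd (c := (1 - p) ^ (-β)) ?_ (Filter.Eventually.of_forall fun z => ?_)
  · exact (((hf.aemeasurable.const_mul p).const_add 1).pow_const (-β)).aestronglyMeasurable
  · have hle := one_sub_le_one_add_mul hp.1 (hf_ge z)
    rw [Real.norm_of_nonneg (Real.rpow_nonneg (hp1.le.trans hle) _)]
    exact Real.rpow_le_rpow_of_nonpos hp1 hle (neg_nonpos.mpr hβ)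

/-- For a finite nonzero jump measure ν with e^z integrable, the power-utility
first-order-condition function is well defined and strictly decreasing on [0,1). -/
theorem power_utility_foc_measure (σ β μ : ℝ) (hσ : 0 < σ) (hβ : 0 < β)
    (ν : Measure ℝ) [IsFiniteMeasure ν] (hν : ν ≠ 0)
    (hexp : Integrable (fun z => Real.exp z) ν) :
    (∀ π ∈ Set.Ico (0 : ℝ) 1,
      Integrable (fun z => (Real.exp z - 1) * (1 + π * (Real.exp z - 1)) ^ (-β)) ν) ∧
    StrictAntiOn
      (fun π : ℝ => μ - β * σ ^ 2 * π +
        ∫ z, (Real.exp z - 1) * (1 + π * (Real.exp z - 1)) ^ (-β) ∂ν)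
      (Set.Ico (0 : ℝ) 1) := by
  have hge : ∀ z : ℝ, -1 ≤ Real.exp z - 1 := fun z => by linarith [Real.exp_pos z]
  have hint : ∀ π ∈ Set.Ico (0 : ℝ) 1,
      Integrable (fun z => (Real.exp z - 1) * (1 + π * (Real.exp z - 1)) ^ (-β)) ν :=
    fun π hπ => integrable_mul_one_add_mul_rpow_neg (hexp.sub (integrable_const 1)) hge hβ.le hπ
  refine ⟨hint, fun p hp q hq hpq => ?_⟩
  have hmono := integral_mono (hint q hq) (hint p hp) fun z =>
    antitoneOn_mul_one_add_mul_rpow_neg hβ.le (hge z) hp hq hpq.le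
  have hlin : β * σ ^ 2 * p < β * σ ^ 2 * q := mul_lt_mul_of_pos_left hpq (by positivity)
  dsimp only
  linarith
end
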